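/- Let k, α, A ∈ ℂ with α ≠ 0 and A² = (α² − 1)(k²α² − 1), and set r(x) := (x² − 1)(k²x² − 1). Then the biquadratic polynomial h(x,y) := (1/(2α))·(k²α²x²y² + 2Axy − x² − y² + α²) satisfies δ_y(h) = r(x) and δ_x(h) = r(y); moreover i₂(h) = 3(k²α² + α^{−2}) − k² − 1 and 4·i₃(h) = A(k²α − α^{−3}). -/

import Mathlib

open MvPolynomial

/-- `δ_{x_i}(h) = h_{x_i}^2 - 2 h h_{x_i x_i}` for a polynomial of two variables
(`x` is the variable indexed `0`, `y` the one indexed `1`). -/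
noncomputable def ds (i : Fin 2) (h : MvPolynomial (Fin 2) ℂ) : MvPolynomial (Fin 2) ℂ :=
  (pderiv i h) ^ 2 - 2 * h * pderiv i (pderiv i h)

/-- The coefficient of `x^i y^j` in `h(x,y)`. -/
noncomputable def cf (h : MvPolynomial (Fin 2) ℂ) (i j : ℕ) : ℂ :=
  h.coeff (Finsupp.single (0 : Fin 2) i + Finsupp.single (1 : Fin 2) j)

/-- `i₂(h) = 8 h₀₀ h₂₂ - 4 h₀₁ h₂₁ - 4 h₁₀ h₁₂ + 8 h₀₂ h₂₀ + h₁₁²`. -/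
noncomputable def inv2 (h : MvPolynomial (Fin 2) ℂ) : ℂ :=
  8 * cf h 0 0 * cf h 2 2 - 4 * cf h 0 1 * cf h 2 1 - 4 * cf h 1 0 * cf h 1 2
    + 8 * cf h 0 2 * cf h 2 0 + (cf h 1 1) ^ 2

/-- `i₃(h) = det [[h₂₂, h₂₁, h₂₀], [h₁₂, h₁₁, h₁₀], [h₀₂, h₀₁, h₀₀]]`. -/
noncomputable def inv3 (h : MvPolynomial (Fin 2) ℂ) : ℂ :=
  Matrix.det !![cf h 2 2, cf h 2 1, cf h 2 0;
                cf h 1 2, cf h 1 1, cf h 1 0;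
                cf h 0 2, cf h 0 1, cf h 0 0]

theorem cf_add (p q : MvPolynomial (Fin 2) ℂ) (i j : ℕ) : cf (p + q) i j = cf p i j + cf q i j :=
  coeff_add _ _ _

theorem cf_C_mul_X_pow_mul_X_pow (a : ℂ) (m n i j : ℕ) :
    cf (C a * X 0 ^ m * X 1 ^ n) i j = if m = i ∧ n = j then a else 0 := by
  have h : (C a * X 0 ^ m * X 1 ^ n : MvPolynomial (Fin 2) ℂ) =
      monomial (Finsupp.single 0 m + Finsupp.single 1 n) a := by
    rw [X_pow_eq_monomial, X_pow_eq_monomial, C_mul_monomial, monomial_mul]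
    simp
  rw [cf, h, coeff_monomial]
  congr 1
  simp [Finsupp.ext_iff, Fin.forall_fin_two]

/-- The biquadratic `h(x,y) = (1/(2α))(k²α²x²y² + 2Axy - x² - y² + α²)` with
`A² = r(α)`, `r(x) = (x²-1)(k²x²-1)`, has discriminants `δ_y(h) = r(x)`, `δ_x(h) = r(y)`
and invariants `i₂ = 3(k²α² + α⁻²) - k² - 1`, `4i₃ = A(k²α - α⁻³)`. -/
theorem statement11 (k α A : ℂ) (hα : α ≠ 0) (hA : A ^ 2 = (α ^ 2 - 1) * (k ^ 2 * α ^ 2 - 1)) :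
    ds 1 (C (1 / (2 * α)) *
        (C (k ^ 2 * α ^ 2) * X 0 ^ 2 * X 1 ^ 2 + C (2 * A) * (X 0 * X 1)
          - X 0 ^ 2 - X 1 ^ 2 + C (α ^ 2))) =
      (X 0 ^ 2 - 1) * (C (k ^ 2) * X 0 ^ 2 - 1) ∧
    ds 0 (C (1 / (2 * α)) *
        (C (k ^ 2 * α ^ 2) * X 0 ^ 2 * X 1 ^ 2 + C (2 * A) * (X 0 * X 1)
          - X 0 ^ 2 - X 1 ^ 2 + C (α ^ 2))) =
      (X 1 ^ 2 - 1) * (C (k ^ 2) * X 1 ^ 2 - 1) ∧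
    inv2 (C (1 / (2 * α)) *
        (C (k ^ 2 * α ^ 2) * X 0 ^ 2 * X 1 ^ 2 + C (2 * A) * (X 0 * X 1)
          - X 0 ^ 2 - X 1 ^ 2 + C (α ^ 2))) =
      3 * (k ^ 2 * α ^ 2 + α⁻¹ ^ 2) - k ^ 2 - 1 ∧
    4 * inv3 (C (1 / (2 * α)) *
        (C (k ^ 2 * α ^ 2) * X 0 ^ 2 * X 1 ^ 2 + C (2 * A) * (X 0 * X 1)
          - X 0 ^ 2 - X 1 ^ 2 + C (α ^ 2))) =
      A * (k ^ 2 * α - α⁻¹ ^ 3) := by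
  have hA' : (C A : MvPolynomial (Fin 2) ℂ) ^ 2 =
      (C α ^ 2 - 1) * (C k ^ 2 * C α ^ 2 - 1) := by
    simpa using congrArg (C : ℂ → MvPolynomial (Fin 2) ℂ) hA
  have hc : (C (1 / (2 * α)) * (2 * C α) : MvPolynomial (Fin 2) ℂ) = 1 := by
    rw [show (2 : MvPolynomial (Fin 2) ℂ) = C 2 from (map_ofNat C 2).symm, ← C_mul, ← C_mul,
      one_div, inv_mul_cancel₀ (by simpa using hα), C_1]
  have h_two : (C 2 : MvPolynomial (Fin 2) ℂ) = 2 := map_ofNat C 2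
  have h_expand : (C (1 / (2 * α)) *
        (C (k ^ 2 * α ^ 2) * X 0 ^ 2 * X 1 ^ 2 + C (2 * A) * (X 0 * X 1)
          - X 0 ^ 2 - X 1 ^ 2 + C (α ^ 2)) : MvPolynomial (Fin 2) ℂ) =
      C (1 / (2 * α) * (k ^ 2 * α ^ 2)) * X 0 ^ 2 * X 1 ^ 2
        + C (1 / (2 * α) * (2 * A)) * X 0 ^ 1 * X 1 ^ 1
        + C (-(1 / (2 * α))) * X 0 ^ 2 * X 1 ^ 0 + C (-(1 / (2 * α))) * X 0 ^ 0 * X 1 ^ 2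
        + C (1 / (2 * α) * α ^ 2) * X 0 ^ 0 * X 1 ^ 0 := by
    simp only [C_mul, C_neg]
    ring
  refine ⟨?_, ?_, ?_, ?_⟩
  · generalize 1 / (2 * α) = c at hc
    simp only [ds, map_add, map_sub, Derivation.leibniz, Derivation.leibniz_pow, pderiv_C,
      pderiv_X_self, pderiv_X_of_ne (zero_ne_one : (0 : Fin 2) ≠ 1), smul_eq_mul, nsmul_eq_mul,
      Derivation.map_natCast]
    simp [h_two]
    linear_combination 4 * C c ^ 2 * X 0 ^ 2 * hA' +
      (C c * (2 * C α) + 1) * ((X 0 ^ 2 - 1) * (C k ^ 2 * X 0 ^ 2 - 1)) * hc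
  · generalize 1 / (2 * α) = c at hc
    simp only [ds, map_add, map_sub, Derivation.leibniz, Derivation.leibniz_pow, pderiv_C,
      pderiv_X_self, pderiv_X_of_ne (one_ne_zero : (1 : Fin 2) ≠ 0), smul_eq_mul, nsmul_eq_mul,
      Derivation.map_natCast]
    simp [h_two]
    linear_combination 4 * C c ^ 2 * X 1 ^ 2 * hA' +
      (C c * (2 * C α) + 1) * ((X 1 ^ 2 - 1) * (C k ^ 2 * X 1 ^ 2 - 1)) * hc
  · rw [h_expand]
    norm_num only [inv2, cf_add, cf_C_mul_X_pow_mul_X_pow, if_true, if_false, and_true, true_and,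
      and_false, false_and]
    field_simp
    linear_combination 4 * hA
  · rw [h_expand]
    simp only [inv3, Matrix.det_fin_three, Matrix.of_apply, Matrix.cons_val]
    norm_num only [cf_add, cf_C_mul_X_pow_mul_X_pow, if_true, if_false, and_true, true_and,
      and_false, false_and]
    field_simp
    ring
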